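/- arXiv:1512.01210 — 5 statements merged into one kernel-verified Lean document; each statement's English description precedes it below -/
import Mathlib

section
/- For every total Boolean function f : {0,1}^m → {0,1} and every n ≥ 1, the unambiguous 0-certificate complexity of AND_n ∘ f satisfies UC_0(AND_n ∘ f) ≤ UC_0(f) + (n−1) · UC_1(f). -/
/-! ### Partial assignments and certificate complexity -/

/-- An input `x` is consistent with a partial assignment `p` if it agrees with
`p` wherever `p` is defined. -/
def Consistent {n : ℕ} (x : Fin n → Bool) (p : Fin n → Option Bool) : Prop :=
  ∀ i : Fin n, ∀ b : Bool, p i = some b → x i = b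

instance {n : ℕ} (x : Fin n → Bool) (p : Fin n → Option Bool) :
    Decidable (Consistent x p) := by unfold Consistent; infer_instance

/-- The width of a partial assignment: the number of fixed coordinates. -/
def paWidth {n : ℕ} (p : Fin n → Option Bool) : ℕ :=
  (Finset.univ.filter (fun i : Fin n => (p i).isSome)).card

/-- `p` is a `b`-certificate for `f`: every input consistent with `p` has value `b`. -/
def IsCert {n : ℕ} (f : (Fin n → Bool) → Bool) (b : Bool) (p : Fin n → Option Bool) : Prop :=
  ∀ x : Fin n → Bool, Consistent x p → f x = b

instance {n : ℕ} (f : (Fin n → Bool) → Bool) (b : Bool) (p : Fin n → Option Bool) :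
    Decidable (IsCert f b p) := by unfold IsCert; infer_instance

/-- The `b`-certificate complexity `C_b(f)`. -/
noncomputable def certC {n : ℕ} (f : (Fin n → Bool) → Bool) (b : Bool) : ℕ :=
  sInf {w : ℕ | ∀ x : Fin n → Bool, f x = b →
    ∃ p : Fin n → Option Bool, IsCert f b p ∧ paWidth p ≤ w ∧ Consistent x p}

/-- The certificate complexity `C(f) = max{C_0(f), C_1(f)}`. -/
noncomputable def certCC {n : ℕ} (f : (Fin n → Bool) → Bool) : ℕ :=
  max (certC f false) (certC f true)

/-- The unambiguous `b`-certificate complexity `UC_b(f)`. -/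
noncomputable def UCb {n : ℕ} (f : (Fin n → Bool) → Bool) (b : Bool) : ℕ :=
  sInf {w : ℕ | ∃ S : Set (Fin n → Option Bool),
    (∀ p ∈ S, IsCert f b p ∧ paWidth p ≤ w) ∧
    ∀ x : Fin n → Bool, f x = b → ∃! p, p ∈ S ∧ Consistent x p}

/-- Subcube partition complexity `UC(f) = max{UC_0(f), UC_1(f)}`. -/
noncomputable def UC {n : ℕ} (f : (Fin n → Bool) → Bool) : ℕ :=
  max (UCb f false) (UCb f true)

/-! ### AND, OR, and composition -/

/-- The `n`-bit AND function. -/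
def ANDn (n : ℕ) : (Fin n → Bool) → Bool := fun x => decide (∀ i, x i = true)

/-- The `n`-bit OR function. -/
def ORn (n : ℕ) : (Fin n → Bool) → Bool := fun x => decide (∃ i, x i = true)

/-- Composition `h ∘ f` of an `n`-bit function with an `m`-bit function,
as a function on `n * m` bits. -/
def composeFn {n m : ℕ} (h : (Fin n → Bool) → Bool) (f : (Fin m → Bool) → Bool) :
    (Fin (n * m) → Bool) → Bool :=
  fun y => h (fun i => f (fun j => y (finProdFinEquiv (i, j))))

/-- The restriction of a function on `n * m` coordinates to its `i`-th block of length `m`. -/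
def blockOf {α : Type*} {n m : ℕ} (p : Fin (n * m) → α) (i : Fin n) : Fin m → α :=
  fun j => p (finProdFinEquiv (i, j))

theorem blockOf_injective {α : Type*} {n m : ℕ} {p q : Fin (n * m) → α}
    (h : ∀ i, blockOf p i = blockOf q i) : p = q := by
  funext z
  obtain ⟨⟨i, j⟩, rfl⟩ := finProdFinEquiv.surjective z
  exact congrFun (h i) j

theorem exists_blockOf_eq {α : Type*} {n m : ℕ} (e : Fin n → Fin m → α) :
    ∃ p : Fin (n * m) → α, ∀ i, blockOf p i = e i :=
  ⟨fun z => e (finProdFinEquiv.symm z).1 (finProdFinEquiv.symm z).2, fun i => by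
    funext j
    simp only [blockOf, Equiv.symm_apply_apply]⟩

theorem consistent_iff_blockOf {n m : ℕ} (x : Fin (n * m) → Bool)
    (p : Fin (n * m) → Option Bool) :
    Consistent x p ↔ ∀ i, Consistent (blockOf x i) (blockOf p i) := by
  refine ⟨fun h i j => h _, fun h z => ?_⟩
  obtain ⟨⟨i, j⟩, rfl⟩ := finProdFinEquiv.surjective z
  exact h i j

theorem paWidth_eq_sum_blockOf {n m : ℕ} (p : Fin (n * m) → Option Bool) :
    paWidth p = ∑ i, paWidth (blockOf p i) := by
  simp only [paWidth, Finset.card_filter]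
  rw [← Equiv.sum_comp finProdFinEquiv, Fintype.sum_prod_type]
  rfl

/-- The fully specified assignments form an unambiguous set of certificates, so the infimum
defining `UCb f b` is attained. -/
theorem exists_unambiguous_certs {n : ℕ} (f : (Fin n → Bool) → Bool) (b : Bool) :
    ∃ S : Set (Fin n → Option Bool),
      (∀ p ∈ S, IsCert f b p ∧ paWidth p ≤ UCb f b) ∧
      ∀ x : Fin n → Bool, f x = b → ∃! p, p ∈ S ∧ Consistent x p := by
  refine Nat.sInf_mem (s := {w : ℕ | ∃ S : Set (Fin n → Option Bool),
    (∀ p ∈ S, IsCert f b p ∧ paWidth p ≤ w) ∧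
    ∀ x : Fin n → Bool, f x = b → ∃! p, p ∈ S ∧ Consistent x p}) ?_
  refine ⟨n, {p | ∃ x, f x = b ∧ p = fun i => some (x i)}, ?_, ?_⟩
  · rintro _ ⟨x, hx, rfl⟩
    refine ⟨fun y hy => ?_, by simp [paWidth]⟩
    rwa [show y = x from funext fun i => hy i _ rfl]
  · intro x hx
    refine ⟨fun i => some (x i), ⟨⟨x, hx, rfl⟩, fun i c h => by simpa using h⟩, ?_⟩
    rintro _ ⟨⟨y, -, rfl⟩, h⟩
    exact funext fun i => congrArg some (h i _ rfl).symm

theorem composeFn_ANDn_eq_false_iff {n m : ℕ} (f : (Fin m → Bool) → Bool)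
    (x : Fin (n * m) → Bool) :
    composeFn (ANDn n) f x = false ↔ ∃ i, f (blockOf x i) = false := by
  simp only [composeFn, ANDn, decide_eq_false_iff_not, not_forall, Bool.not_eq_true]
  rfl

/-- Assignments whose blocks before `k` lie in `S₁`, whose block `k` lies in `S₀`, and whose
later blocks are unspecified. -/
def firstFalseCert {n m : ℕ} (S₀ S₁ : Set (Fin m → Option Bool)) (k : Fin n)
    (p : Fin (n * m) → Option Bool) : Prop :=
  (∀ i < k, blockOf p i ∈ S₁) ∧ blockOf p k ∈ S₀ ∧ ∀ i, k < i → blockOf p i = fun _ => none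

theorem paWidth_le_of_firstFalseCert {n m : ℕ} {S₀ S₁ : Set (Fin m → Option Bool)} {k : Fin n}
    {p : Fin (n * m) → Option Bool} {u v : ℕ} (h₀ : ∀ q ∈ S₀, paWidth q ≤ u)
    (h₁ : ∀ q ∈ S₁, paWidth q ≤ v) (hp : firstFalseCert S₀ S₁ k p) :
    paWidth p ≤ u + (n - 1) * v := by
  obtain ⟨hlt, hk, hgt⟩ := hp
  rw [paWidth_eq_sum_blockOf, ← Finset.add_sum_erase _ _ (Finset.mem_univ k)]
  refine Nat.add_le_add (h₀ _ hk) ?_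
  calc ∑ i ∈ Finset.univ.erase k, paWidth (blockOf p i)
      ≤ (Finset.univ.erase k).card • v := Finset.sum_le_card_nsmul _ _ _ fun i hi => by
        rcases lt_or_gt_of_ne (Finset.ne_of_mem_erase hi) with h | h
        · exact h₁ _ (hlt i h)
        · simp [hgt i h, paWidth]
    _ = (n - 1) * v := by simp

theorem stmt7 {m : ℕ} (f : (Fin m → Bool) → Bool) (n : ℕ) (hn : 1 ≤ n) :
    UCb (composeFn (ANDn n) f) false ≤ UCb f false + (n - 1) * UCb f true := by
  obtain ⟨S₀, hS₀, hu₀⟩ := exists_unambiguous_certs f false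
  obtain ⟨S₁, hS₁, hu₁⟩ := exists_unambiguous_certs f true
  refine Nat.sInf_le ⟨{p | ∃ k, firstFalseCert S₀ S₁ k p}, ?_, ?_⟩
  · rintro p ⟨k, hp⟩
    refine ⟨fun x hx => (composeFn_ANDn_eq_false_iff f x).2 ⟨k, ?_⟩,
      paWidth_le_of_firstFalseCert (fun q hq => (hS₀ q hq).2) (fun q hq => (hS₁ q hq).2) hp⟩
    exact (hS₀ _ hp.2.1).1 _ ((consistent_iff_blockOf x p).1 hx k)
  · intro x hx
    obtain ⟨k, hk, hmin⟩ := WellFounded.has_min (wellFounded_lt (α := Fin n))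
      {i | f (blockOf x i) = false} ((composeFn_ANDn_eq_false_iff f x).1 hx)
    have hlt : ∀ i < k, f (blockOf x i) = true := fun i hi => by
      simpa using fun h => hmin i h hi
    choose! c hc hc' using fun y hy => (hu₁ y hy).exists
    obtain ⟨d, ⟨hd, hd'⟩, -⟩ := hu₀ _ hk
    obtain ⟨r, hr⟩ := exists_blockOf_eq fun i =>
      if i < k then c (blockOf x i) else if i = k then d else fun _ => none
    refine existsUnique_of_exists_of_unique ⟨r, ⟨k, ?_, ?_, ?_⟩,
      (consistent_iff_blockOf x _).2 fun i => ?_⟩ ?_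
    · intro i hi
      rw [hr]
      simpa [hi] using hc _ (hlt i hi)
    · rw [hr]
      simpa using hd
    · intro i hi
      rw [hr]
      simp [hi.not_gt, hi.ne']
    · rw [hr]
      rcases lt_trichotomy i k with h | rfl | h
      · simpa [h] using hc' _ (hlt i h)
      · simpa using hd'
      · simp [h.not_gt, h.ne', Consistent]
    · have index_eq : ∀ p l, firstFalseCert S₀ S₁ l p → Consistent x p → l = k := by
        intro p l hp hxp
        have hb := (consistent_iff_blockOf x p).1 hxp
        have hl : f (blockOf x l) = false := (hS₀ _ hp.2.1).1 _ (hb l)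
        refine le_antisymm (not_lt.1 fun h => ?_) (not_lt.1 (hmin l hl))
        exact Bool.false_ne_true (hk.symm.trans ((hS₁ _ (hp.1 k h)).1 _ (hb k)))
      rintro p q ⟨⟨l, hp⟩, hxp⟩ ⟨⟨l', hq⟩, hxq⟩
      obtain rfl := index_eq p l hp hxp
      obtain rfl := index_eq q l' hq hxq
      have hbp := (consistent_iff_blockOf x p).1 hxp
      have hbq := (consistent_iff_blockOf x q).1 hxq
      refine blockOf_injective fun i => ?_
      rcases lt_trichotomy i l' with h | rfl | h
      · exact (hu₁ _ (hlt i h)).unique ⟨hp.1 i h, hbp i⟩ ⟨hq.1 i h, hbq i⟩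
      · exact (hu₀ _ hk).unique ⟨hp.2.1, hbp i⟩ ⟨hq.2.1, hbq i⟩
      · rw [hp.2.2 i h, hq.2.2 i h]
end

section
/- For every total Boolean function f : {0,1}^m → {0,1} and every n ≥ 1, the unambiguous 1-certificate complexity of OR_n ∘ f satisfies UC_1(OR_n ∘ f) ≤ (n−1) · UC_0(f) + UC_1(f). -/
/-- Glue blockwise partial assignments into one partial assignment. -/
def gluePA {n m : ℕ} (P : Fin n → Fin m → Option Bool) : Fin (n * m) → Option Bool :=
  fun t => P (finProdFinEquiv.symm t).1 (finProdFinEquiv.symm t).2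

theorem consistent_gluePA {n m : ℕ} (P : Fin n → Fin m → Option Bool)
    (y : Fin (n * m) → Bool) :
    Consistent y (gluePA P) ↔
      ∀ i, Consistent (fun j => y (finProdFinEquiv (i, j))) (P i) := by
  constructor
  · intro h i j b hb
    exact h _ b (by simpa only [gluePA, Equiv.symm_apply_apply] using hb)
  · intro h t b hb
    have := h _ _ b hb
    simpa only [Prod.mk.eta, Equiv.apply_symm_apply] using this

theorem paWidth_gluePA {n m : ℕ} (P : Fin n → Fin m → Option Bool) :
    paWidth (gluePA P) = ∑ i, paWidth (P i) := by
  simp only [paWidth, Finset.card_filter]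
  rw [← finProdFinEquiv.sum_comp, Fintype.sum_prod_type]
  simp only [gluePA, Equiv.symm_apply_apply]

theorem composeFn_ORn_eq_true {n m : ℕ} (f : (Fin m → Bool) → Bool)
    (y : Fin (n * m) → Bool) :
    composeFn (ORn n) f y = true ↔ ∃ i, f (fun j => y (finProdFinEquiv (i, j))) = true := by
  simp [composeFn, ORn]

theorem stmt12 {m : ℕ} (f : (Fin m → Bool) → Bool) (n : ℕ) (hn : 1 ≤ n) :
    UCb (composeFn (ORn n) f) true ≤ (n - 1) * UCb f false + UCb f true := by
  obtain ⟨S₀, hS₀, hU₀⟩ := exists_unambiguous_certs f false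
  obtain ⟨S₁, hS₁, hU₁⟩ := exists_unambiguous_certs f true
  refine Nat.sInf_le ⟨{q | ∃ (k : Fin n) (P : Fin n → Fin m → Option Bool),
    (∀ i < k, P i ∈ S₀) ∧ P k ∈ S₁ ∧ (∀ i, k < i → P i = fun _ => none) ∧ q = gluePA P}, ?_, ?_⟩
  · rintro q ⟨k, P, h₀, h₁, h, rfl⟩
    refine ⟨fun y hy => ?_, ?_⟩
    · rw [consistent_gluePA] at hy
      exact (composeFn_ORn_eq_true f y).2 ⟨k, (hS₁ _ h₁).1 _ (hy k)⟩
    · rw [paWidth_gluePA, ← Finset.sum_erase_add _ _ (Finset.mem_univ k)]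
      refine add_le_add ?_ (hS₁ _ h₁).2
      refine (Finset.sum_le_card_nsmul _ _ (UCb f false) fun i hi => ?_).trans (by simp)
      rcases lt_or_gt_of_ne (Finset.ne_of_mem_erase hi) with hik | hik
      · exact (hS₀ _ (h₀ i hik)).2
      · simp [h i hik, paWidth]
  · intro y hy
    set z : Fin n → Fin m → Bool := fun i j => y (finProdFinEquiv (i, j)) with hz
    obtain ⟨k, hk, hmin⟩ := WellFounded.has_min (wellFounded_lt (α := Fin n))
      {i | f (z i) = true} ((composeFn_ORn_eq_true f y).1 hy)
    have hlt : ∀ i < k, f (z i) = false := fun i hi =>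
      Bool.eq_false_iff.2 fun h => hmin i h hi
    obtain ⟨p₁, ⟨hp₁, hc₁⟩, hu₁⟩ := hU₁ (z k) hk
    choose p₀ hp₀ hu₀ using fun i (hi : i < k) => hU₀ (z i) (hlt i hi)
    refine ⟨gluePA fun i => if hi : i < k then p₀ i hi else if i = k then p₁ else fun _ => none,
      ⟨⟨k, _, ?_, ?_, ?_, rfl⟩, ?_⟩, ?_⟩
    · intro i hi
      simpa [hi] using (hp₀ i hi).1
    · simpa using hp₁
    · intro i hi
      simp [hi.not_gt, hi.ne']
    · rw [consistent_gluePA]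
      intro i
      rcases lt_trichotomy i k with hi | rfl | hi
      · simpa [hi] using (hp₀ i hi).2
      · simpa using hc₁
      · simp [hi.not_gt, hi.ne', Consistent]
    · rintro q ⟨⟨k', P, h₀, h₁, h, rfl⟩, hc⟩
      rw [consistent_gluePA] at hc
      have hk' : f (z k') = true := (hS₁ _ h₁).1 _ (hc k')
      obtain rfl : k' = k := by
        refine le_antisymm (not_lt.1 fun hlt' => ?_) (not_lt.1 (hmin k' hk'))
        have := (hS₀ _ (h₀ k hlt')).1 _ (hc k)
        exact absurd (hk.symm.trans this) (by simp)
      congr 1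
      funext i
      rcases lt_trichotomy i k' with hi | rfl | hi
      · simpa [hi] using hu₀ i hi _ ⟨h₀ i hi, hc i⟩
      · simpa using hu₁ _ ⟨h₁, hc i⟩
      · simp [hi.not_gt, hi.ne', h i hi]
end

section
/- There is a universal constant a > 0 such that for every N ≥ 2 and every total Boolean function f : {0,1}^N → {0,1}, the cheat sheet version f_CS satisfies C_1(f_CS) ≤ a · C(f) · (log₂ N)². -/
/-! ### The cheat sheet construction -/

/-- Interpret `g 0, …, g (L-1)` as the binary representation of a number. -/
def bitsToNat (L : ℕ) (g : ℕ → Bool) : ℕ :=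
  ∑ t ∈ Finset.range L, if g t then 2 ^ t else 0

/-- Read position `p` of the cell `Y` (`0` when the cell is empty). -/
def cellBit {m : ℕ} (Y : Fin m → Bool) (p : ℕ) : Bool :=
  if h : p % m < m then Y ⟨p % m, h⟩ else false

/-- Decode the `i`-th partial assignment stored in the cell `Y`: it is given by
`Cf` pairs, each consisting of an index (written in `L` bits) and a value bit. -/
def decodePA (N L Cf : ℕ) {m : ℕ} (Y : Fin m → Bool) (i : ℕ) : Fin N → Option Bool :=
  fun j =>
    ((List.range Cf).find? (fun t =>
        bitsToNat L (fun s => cellBit Y ((i * Cf + t) * (L + 1) + s)) == (j : ℕ))).map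
      (fun t => cellBit Y ((i * Cf + t) * (L + 1) + L))

/-- The cheat sheet version of `f`, on its natural (structured) input domain:
`c` inputs to `f` together with `2^c` cells of `m` bits each. -/
noncomputable def cheatSheetAux {N : ℕ} (f : (Fin N → Bool) → Bool) :
    ((Fin (10 * Nat.clog 2 N) × Fin N) ⊕
      (Fin (2 ^ (10 * Nat.clog 2 N)) × Fin (10 * certCC f * (Nat.clog 2 N) ^ 2)) → Bool)
    → Bool :=
  fun z =>
    let c := 10 * Nat.clog 2 N
    let x : Fin c → (Fin N → Bool) := fun i j => z (Sum.inl (i, j))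
    let ℓb : Fin c → Bool := fun i => f (x i)
    let ℓ : ℕ := ∑ i : Fin c, if ℓb i then 2 ^ (c - 1 - (i : ℕ)) else 0
    let Y : Fin (10 * certCC f * (Nat.clog 2 N) ^ 2) → Bool :=
      fun j => z (Sum.inr (⟨ℓ % 2 ^ c, Nat.mod_lt _ (by positivity)⟩, j))
    decide (∀ i : Fin c,
      Consistent (x i) (decodePA N (Nat.clog 2 N) (certCC f) Y (i : ℕ)) ∧
      IsCert f (ℓb i) (decodePA N (Nat.clog 2 N) (certCC f) Y (i : ℕ)))

/-- Number of input bits of the cheat sheet version of an `N`-bit function with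
certificate complexity `Cf`. -/
def csCard (N Cf : ℕ) : ℕ :=
  10 * Nat.clog 2 N * N + 2 ^ (10 * Nat.clog 2 N) * (10 * Cf * (Nat.clog 2 N) ^ 2)

/-- Relabelling of the structured cheat sheet domain as a set of `csCard N Cf` bits. -/
def csIndex (N Cf : ℕ) :
    (Fin (10 * Nat.clog 2 N) × Fin N) ⊕
      (Fin (2 ^ (10 * Nat.clog 2 N)) × Fin (10 * Cf * (Nat.clog 2 N) ^ 2))
    ≃ Fin (csCard N Cf) :=
  (Equiv.sumCongr finProdFinEquiv finProdFinEquiv).trans finSumFinEquiv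

/-- The cheat sheet version `f_CS` of `f`, as a total Boolean function on
`csCard N (C f)` bits. -/
noncomputable def cheatSheet {N : ℕ} (f : (Fin N → Bool) → Bool) :
    (Fin (csCard N (certCC f)) → Bool) → Bool :=
  fun z => cheatSheetAux f (fun u => z (csIndex N (certCC f) u))

theorem certC_le_of_forall {n : ℕ} {f : (Fin n → Bool) → Bool} {b : Bool} {w : ℕ}
    (h : ∀ x : Fin n → Bool, f x = b →
      ∃ p : Fin n → Option Bool, IsCert f b p ∧ paWidth p ≤ w ∧ Consistent x p) :
    certC f b ≤ w :=
  Nat.sInf_le h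

/-- A decoded partial assignment fixes at most one coordinate per stored pair. -/
theorem paWidth_decodePA_le (N L Cf : ℕ) {m : ℕ} (Y : Fin m → Bool) (i : ℕ) :
    paWidth (decodePA N L Cf Y i) ≤ Cf := by
  let addr : ℕ → ℕ := fun t =>
    bitsToNat L (fun s => cellBit Y ((i * Cf + t) * (L + 1) + s))
  have hsub : (Finset.univ.filter fun j : Fin N => (decodePA N L Cf Y i j).isSome).map
      Fin.valEmbedding ⊆ (Finset.range Cf).image addr := by
    intro k hk
    simp only [Finset.mem_map, Finset.mem_filter, Finset.mem_univ, true_and] at hk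
    obtain ⟨j, hj, rfl⟩ := hk
    simp only [decodePA, Option.isSome_map, List.find?_isSome, List.mem_range,
      beq_iff_eq] at hj
    obtain ⟨t, ht, htj⟩ := hj
    exact Finset.mem_image.2 ⟨t, Finset.mem_range.2 ht, htj⟩
  calc paWidth (decodePA N L Cf Y i)
      = ((Finset.univ.filter fun j : Fin N => (decodePA N L Cf Y i j).isSome).map
          Fin.valEmbedding).card := (Finset.card_map _).symm
    _ ≤ ((Finset.range Cf).image addr).card := Finset.card_le_card hsub
    _ ≤ Cf := Finset.card_image_le.trans (Finset.card_range Cf).le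

/-- The cell selected by the answer bits `l`. -/
def cellAddr {c : ℕ} (l : Fin c → Bool) : Fin (2 ^ c) :=
  ⟨(∑ i : Fin c, if l i then 2 ^ (c - 1 - (i : ℕ)) else 0) % 2 ^ c,
    Nat.mod_lt _ (by positivity)⟩

theorem cheatSheetAux_eq_true_iff {N : ℕ} (f : (Fin N → Bool) → Bool)
    (z : ((Fin (10 * Nat.clog 2 N) × Fin N) ⊕
      (Fin (2 ^ (10 * Nat.clog 2 N)) × Fin (10 * certCC f * (Nat.clog 2 N) ^ 2)) → Bool)) :
    cheatSheetAux f z = true ↔ ∀ i : Fin (10 * Nat.clog 2 N),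
      Consistent (fun j => z (Sum.inl (i, j))) (decodePA N (Nat.clog 2 N) (certCC f)
        (fun j => z (Sum.inr (cellAddr fun i => f fun j => z (Sum.inl (i, j)), j))) i) ∧
      IsCert f (f fun j => z (Sum.inl (i, j))) (decodePA N (Nat.clog 2 N) (certCC f)
        (fun j => z (Sum.inr (cellAddr fun i => f fun j => z (Sum.inl (i, j)), j))) i) := by
  simp only [cheatSheetAux, decide_eq_true_eq]
  rfl

/-- The partial assignment revealing the coordinates of the `i`-th input fixed by `p i`, and
the whole cell `k`. -/
def revealPA {c n K m : ℕ} (z : (Fin c × Fin n) ⊕ (Fin K × Fin m) → Bool)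
    (p : Fin c → Fin n → Option Bool) (k : Fin K) :
    (Fin c × Fin n) ⊕ (Fin K × Fin m) → Option Bool
  | Sum.inl (i, j) => if (p i j).isSome then some (z (Sum.inl (i, j))) else none
  | Sum.inr (k', j) => if k' = k then some (z (Sum.inr (k', j))) else none

theorem eq_of_revealPA_eq_some {c n K m : ℕ} {z : (Fin c × Fin n) ⊕ (Fin K × Fin m) → Bool}
    {p : Fin c → Fin n → Option Bool} {k : Fin K} {u : (Fin c × Fin n) ⊕ (Fin K × Fin m)}
    {b : Bool} (h : revealPA z p k u = some b) : z u = b := by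
  rcases u with ⟨i, j⟩ | ⟨k', j⟩ <;> simp only [revealPA] at h <;> split_ifs at h <;>
    exact Option.some.inj h

theorem card_revealPA_isSome {c n K m : ℕ} (z : (Fin c × Fin n) ⊕ (Fin K × Fin m) → Bool)
    (p : Fin c → Fin n → Option Bool) (k : Fin K) :
    (Finset.univ.filter fun u => (revealPA z p k u).isSome).card =
      ∑ i, paWidth (p i) + m := by
  simp only [Finset.card_filter, Fintype.sum_sum_type, Fintype.sum_prod_type, paWidth]
  congr 1
  · refine Finset.sum_congr rfl fun i _ => Finset.sum_congr rfl fun j _ => ?_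
    by_cases h : (p i j).isSome <;> simp [revealPA, h]
  · rw [Finset.sum_eq_single k]
    · simp [revealPA]
    · intro k' _ hk
      simp [revealPA, hk]
    · simp

theorem paWidth_comp_symm {α : Type*} [Fintype α] {n : ℕ} (e : α ≃ Fin n)
    (q : α → Option Bool) :
    paWidth (fun v => q (e.symm v)) = (Finset.univ.filter fun u => (q u).isSome).card := by
  simp only [paWidth, Finset.card_filter]
  exact Equiv.sum_comp e.symm fun u => if (q u).isSome then 1 else 0

/-- Inputs agreeing on the selected cell and on the certificates it stores are both accepted. -/
theorem cheatSheetAux_eq_true_of_reveal {N : ℕ} {f : (Fin N → Bool) → Bool}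
    {z z' : ((Fin (10 * Nat.clog 2 N) × Fin N) ⊕
      (Fin (2 ^ (10 * Nat.clog 2 N)) × Fin (10 * certCC f * (Nat.clog 2 N) ^ 2)) → Bool)}
    (hz : cheatSheetAux f z = true)
    (h : ∀ u b, revealPA z (fun i => decodePA N (Nat.clog 2 N) (certCC f)
        (fun j => z (Sum.inr (cellAddr fun i => f fun j => z (Sum.inl (i, j)), j))) i)
        (cellAddr fun i => f fun j => z (Sum.inl (i, j))) u = some b → z' u = b) :
    cheatSheetAux f z' = true := by
  rw [cheatSheetAux_eq_true_iff] at hz ⊢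
  have hcons : ∀ i : Fin (10 * Nat.clog 2 N), Consistent (fun j => z' (Sum.inl (i, j)))
      (decodePA N (Nat.clog 2 N) (certCC f)
        (fun j => z (Sum.inr (cellAddr fun i => f fun j => z (Sum.inl (i, j)), j))) i) := by
    intro i j b hb
    rw [← (hz i).1 j b hb]
    exact h _ _ (by simp [revealPA, hb])
  have hval : ∀ i : Fin (10 * Nat.clog 2 N),
      f (fun j => z' (Sum.inl (i, j))) = f (fun j => z (Sum.inl (i, j))) :=
    fun i => (hz i).2 _ (hcons i)
  have hcell : ∀ j, z' (Sum.inr (cellAddr fun i => f fun j => z (Sum.inl (i, j)), j)) =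
      z (Sum.inr (cellAddr fun i => f fun j => z (Sum.inl (i, j)), j)) :=
    fun j => h _ _ (by simp [revealPA])
  simp only [hval, hcell]
  exact fun i => ⟨hcons i, (hz i).2⟩

theorem certC_cheatSheet_true_le {N : ℕ} (f : (Fin N → Bool) → Bool) :
    certC (cheatSheet f) true ≤
      10 * Nat.clog 2 N * certCC f + 10 * certCC f * Nat.clog 2 N ^ 2 := by
  refine certC_le_of_forall fun x hx => ?_
  let e := csIndex N (certCC f)
  let z := fun u => x (e u)
  let k := cellAddr fun i => f fun j => z (Sum.inl (i, j))
  let p : Fin (10 * Nat.clog 2 N) → Fin N → Option Bool := fun i =>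
    decodePA N (Nat.clog 2 N) (certCC f) (fun j => z (Sum.inr (k, j))) i
  refine ⟨fun v => revealPA z p k (e.symm v), fun y hy => ?_, ?_, fun v b hb => ?_⟩
  · refine cheatSheetAux_eq_true_of_reveal (z := z) hx fun u b hb => hy (e u) b ?_
    simpa only [Equiv.symm_apply_apply] using hb
  · rw [paWidth_comp_symm, card_revealPA_isSome]
    gcongr
    calc ∑ i, paWidth (p i) ≤ ∑ _i : Fin (10 * Nat.clog 2 N), certCC f :=
          Finset.sum_le_sum fun i _ => paWidth_decodePA_le ..
      _ = 10 * Nat.clog 2 N * certCC f := by simp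
  · have := eq_of_revealPA_eq_some hb
    simpa only [z, Equiv.apply_symm_apply] using this

theorem natClog_two_le_two_mul_logb {N : ℕ} (hN : 2 ≤ N) :
    (Nat.clog 2 N : ℝ) ≤ 2 * Real.logb 2 N := by
  have hlog : (1 : ℝ) ≤ Real.logb 2 N := by
    rw [Real.le_logb_iff_rpow_le (by norm_num) (by positivity), Real.rpow_one]
    exact_mod_cast hN
  have hceil : (Nat.clog 2 N : ℝ) < Real.logb 2 N + 1 := by
    have h := Real.ceil_logb_natCast (b := 2) (r := (N : ℝ)) (by positivity)
    rw [Int.clog_natCast] at h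
    have h' := Int.ceil_lt_add_one (Real.logb 2 (N : ℝ))
    push_cast at h
    rw [h] at h'
    exact_mod_cast h'
  linarith

theorem stmt14 :
    ∃ a : ℝ, 0 < a ∧ ∀ N : ℕ, 2 ≤ N → ∀ f : (Fin N → Bool) → Bool,
      (certC (cheatSheet f) true : ℝ) ≤ a * certCC f * Real.logb 2 N ^ 2 := by
  refine ⟨80, by norm_num, fun N hN f => ?_⟩
  have hpos : 1 ≤ Nat.clog 2 N := Nat.clog_pos (by norm_num) hN
  have hnat : certC (cheatSheet f) true ≤ 20 * certCC f * Nat.clog 2 N ^ 2 := by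
    have h := certC_cheatSheet_true_le f
    have hsq : Nat.clog 2 N ≤ Nat.clog 2 N ^ 2 := Nat.le_self_pow (by norm_num) _
    have hmul := Nat.mul_le_mul_left (10 * certCC f) hsq
    linarith
  calc (certC (cheatSheet f) true : ℝ) ≤ 20 * certCC f * (Nat.clog 2 N : ℝ) ^ 2 := by
        exact_mod_cast hnat
    _ ≤ 20 * certCC f * (2 * Real.logb 2 N) ^ 2 := by
        gcongr
        exact natClog_two_le_two_mul_logb hN
    _ = 80 * certCC f * Real.logb 2 N ^ 2 := by ring
end

section
/- Define the family f_0 = AND_n and f_k = AND_n ∘ (OR_n ∘ f_{k−1})_CS for k ≥ 1, where (·)_CS is the cheat sheet construction. Then for every fixed integer k ≥ 0 there exist constants a_k, d_k > 0 such that for all n ≥ 2: the input size N_k of f_k satisfies N_k ≤ a_k · n^(25^k), and moreover C_0(f_k) ≤ a_k · n^k · (log₂ n)^{d_k}, C_1(f_k) ≤ a_k · n^(k+1) · (log₂ n)^{d_k}, UC_0(f_k) ≤ a_k · n^(k+1) · (log₂ n)^{d_k}, and UC_1(f_k) ≤ a_k · n^(k+1) · (log₂ n)^{d_k}. -/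
/-! ### The function family `f_0 = AND_n`, `f_k = AND_n ∘ (OR_n ∘ f_{k-1})_CS` -/

/-- `family n k` is (the number of input bits of, together with) the function
`f_k` where `f_0 = AND_n` and `f_k = AND_n ∘ (OR_n ∘ f_{k-1})_CS`. -/
noncomputable def family (n : ℕ) : ℕ → Σ N : ℕ, ((Fin N → Bool) → Bool)
  | 0 => ⟨n, ANDn n⟩
  | k + 1 =>
      ⟨n * csCard (n * (family n k).1) (certCC (composeFn (ORn n) (family n k).2)),
        composeFn (ANDn n) (cheatSheet (composeFn (ORn n) (family n k).2))⟩

/-! ### Certificates as sets of queried coordinates -/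

open Classical in
/-- The partial assignment that records `x` on the coordinates in `s`. -/
noncomputable def restrictPA {n : ℕ} (x : Fin n → Bool) (s : Finset (Fin n)) :
    Fin n → Option Bool :=
  fun i => if i ∈ s then some (x i) else none

/-- The set of coordinates fixed by a partial assignment. -/
def paDom {n : ℕ} (p : Fin n → Option Bool) : Finset (Fin n) :=
  Finset.univ.filter (fun i => (p i).isSome)

/-- Every `b`-input `x` of `f` has a set `s x` of at most `w` coordinates which certifies
`f x = b`; if `u` holds, the sets `s x` are moreover determined by the bits they reveal. -/
def HasCerts {ι : Type*} (u : Prop) (f : (ι → Bool) → Bool) (b : Bool) (w : ℕ) : Prop :=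
  ∃ s : (ι → Bool) → Finset ι, ∀ x, f x = b →
    (s x).card ≤ w ∧ ∀ y, (∀ i ∈ s x, y i = x i) → f y = b ∧ (u → s y = s x)

lemma consistent_restrictPA {n : ℕ} (x y : Fin n → Bool) (s : Finset (Fin n)) :
    Consistent y (restrictPA x s) ↔ ∀ i ∈ s, y i = x i := by
  unfold Consistent restrictPA
  constructor
  · intro h i hi
    exact h i (x i) (by simp [hi])
  · intro h i b hb
    by_cases hi : i ∈ s
    · simp only [hi, if_true, Option.some.injEq] at hb
      rw [h i hi, hb]
    · simp [hi] at hb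

lemma paWidth_restrictPA {n : ℕ} (x : Fin n → Bool) (s : Finset (Fin n)) :
    paWidth (restrictPA x s) = s.card := by
  unfold paWidth restrictPA
  congr 1
  ext i
  by_cases hi : i ∈ s <;> simp [hi]

lemma restrictPA_congr {n : ℕ} {x y : Fin n → Bool} {s : Finset (Fin n)}
    (h : ∀ i ∈ s, y i = x i) : restrictPA y s = restrictPA x s := by
  funext i
  by_cases hi : i ∈ s
  · simp [restrictPA, hi, h i hi]
  · simp [restrictPA, hi]

lemma consistent_congr {n : ℕ} {x y : Fin n → Bool} {p : Fin n → Option Bool}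
    (h : ∀ i ∈ paDom p, y i = x i) : Consistent y p ↔ Consistent x p := by
  refine forall_congr' fun i => forall_congr' fun b => imp_congr_right fun hb => ?_
  rw [h i (by simp [paDom, hb])]

lemma hasCerts_full {n : ℕ} (u : Prop) (f : (Fin n → Bool) → Bool) (b : Bool) :
    HasCerts u f b n := by
  refine ⟨fun _ => Finset.univ, fun x hx => ⟨by simp, fun y hy => ?_⟩⟩
  have : y = x := funext fun i => hy i (Finset.mem_univ i)
  exact ⟨this ▸ hx, fun _ => rfl⟩

lemma HasCerts.isCert {n : ℕ} {f : (Fin n → Bool) → Bool} {b : Bool} {x : Fin n → Bool}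
    {s : Finset (Fin n)} (h : ∀ y, (∀ i ∈ s, y i = x i) → f y = b) :
    IsCert f b (restrictPA x s) :=
  fun y hy => h y ((consistent_restrictPA x y s).1 hy)

lemma HasCerts.certC_le {n : ℕ} {f : (Fin n → Bool) → Bool} {b : Bool} {w : ℕ}
    (h : HasCerts False f b w) : certC f b ≤ w := by
  obtain ⟨s, hs⟩ := h
  refine Nat.sInf_le fun x hx => ⟨restrictPA x (s x), ?_, ?_, ?_⟩
  · exact HasCerts.isCert fun y hy => ((hs x hx).2 y hy).1
  · rw [paWidth_restrictPA]
    exact (hs x hx).1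
  · rw [consistent_restrictPA]
    exact fun _ _ => rfl

lemma HasCerts.UCb_le {n : ℕ} {f : (Fin n → Bool) → Bool} {b : Bool} {w : ℕ}
    (h : HasCerts True f b w) : UCb f b ≤ w := by
  obtain ⟨s, hs⟩ := h
  refine Nat.sInf_le ⟨{p | ∃ x, f x = b ∧ p = restrictPA x (s x)}, ?_, ?_⟩
  · rintro p ⟨x, hx, rfl⟩
    refine ⟨HasCerts.isCert fun y hy => ((hs x hx).2 y hy).1, ?_⟩
    rw [paWidth_restrictPA]
    exact (hs x hx).1
  · intro x hx
    refine ⟨restrictPA x (s x), ⟨⟨x, hx, rfl⟩, ?_⟩, ?_⟩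
    · rw [consistent_restrictPA]
      exact fun _ _ => rfl
    · rintro p ⟨⟨y, hy, rfl⟩, hc⟩
      rw [consistent_restrictPA] at hc
      rw [((hs y hy).2 x hc).2 trivial, restrictPA_congr hc]

lemma hasCerts_certC {n : ℕ} (f : (Fin n → Bool) → Bool) (b : Bool) :
    HasCerts False f b (certC f b) := by
  have hne : {w : ℕ | ∀ x : Fin n → Bool, f x = b →
      ∃ p : Fin n → Option Bool, IsCert f b p ∧ paWidth p ≤ w ∧ Consistent x p}.Nonempty := by
    obtain ⟨s, hs⟩ := hasCerts_full False f b
    refine ⟨n, fun x hx => ⟨restrictPA x (s x), ?_, ?_, ?_⟩⟩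
    · exact HasCerts.isCert fun y hy => ((hs x hx).2 y hy).1
    · rw [paWidth_restrictPA]
      exact (hs x hx).1
    · rw [consistent_restrictPA]
      exact fun _ _ => rfl
  have hmem : ∀ x : Fin n → Bool, f x = b →
      ∃ p : Fin n → Option Bool, IsCert f b p ∧ paWidth p ≤ certC f b ∧ Consistent x p :=
    Nat.sInf_mem hne
  choose! p hp using hmem
  refine ⟨fun x => paDom (p x), fun x hx => ⟨(hp x hx).2.1, fun y hy => ⟨?_, False.elim⟩⟩⟩
  exact (hp x hx).1 y ((consistent_congr hy).2 (hp x hx).2.2)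

lemma hasCerts_UCb {n : ℕ} (f : (Fin n → Bool) → Bool) (b : Bool) :
    HasCerts True f b (UCb f b) := by
  have hne : {w : ℕ | ∃ S : Set (Fin n → Option Bool),
      (∀ p ∈ S, IsCert f b p ∧ paWidth p ≤ w) ∧
      ∀ x : Fin n → Bool, f x = b → ∃! p, p ∈ S ∧ Consistent x p}.Nonempty := by
    refine ⟨n, {p | ∃ x, f x = b ∧ p = restrictPA x Finset.univ}, ?_, ?_⟩
    · rintro p ⟨x, hx, rfl⟩
      refine ⟨HasCerts.isCert fun y hy => ?_, by simp [paWidth_restrictPA]⟩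
      rwa [show y = x from funext fun i => hy i (Finset.mem_univ i)]
    · intro x hx
      refine ⟨restrictPA x Finset.univ, ⟨⟨x, hx, rfl⟩, by simp [consistent_restrictPA]⟩, ?_⟩
      rintro p ⟨⟨y, hy, rfl⟩, hc⟩
      rw [consistent_restrictPA] at hc
      rw [restrictPA_congr hc]
  obtain ⟨S, hS, hex⟩ : ∃ S : Set (Fin n → Option Bool),
      (∀ p ∈ S, IsCert f b p ∧ paWidth p ≤ UCb f b) ∧
      ∀ x : Fin n → Bool, f x = b → ∃! p, p ∈ S ∧ Consistent x p := Nat.sInf_mem hne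
  have hex' : ∀ x : Fin n → Bool, f x = b → ∃ p, (p ∈ S ∧ Consistent x p) ∧
      ∀ q, q ∈ S ∧ Consistent x q → q = p := hex
  choose! p hp using hex'
  refine ⟨fun x => paDom (p x), fun x hx => ⟨(hS _ (hp x hx).1.1).2, fun y hy => ?_⟩⟩
  have hc := (consistent_congr hy).2 (hp x hx).1.2
  have hfy := (hS _ (hp x hx).1.1).1 y hc
  refine ⟨hfy, fun _ => ?_⟩
  dsimp only
  rw [← (hp y hfy).2 (p x) ⟨(hp x hx).1.1, hc⟩]

lemma certC_le_size {n : ℕ} (f : (Fin n → Bool) → Bool) (b : Bool) : certC f b ≤ n :=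
  (hasCerts_full False f b).certC_le

lemma certCC_le_size {n : ℕ} (f : (Fin n → Bool) → Bool) : certCC f ≤ n :=
  max_le (certC_le_size f _) (certC_le_size f _)

section General

variable {ι κ : Type*}

lemma HasCerts.mono {u : Prop} {f : (ι → Bool) → Bool} {b : Bool} {w w' : ℕ}
    (h : HasCerts u f b w) (hw : w ≤ w') : HasCerts u f b w' := by
  obtain ⟨s, hs⟩ := h
  exact ⟨s, fun x hx => ⟨(hs x hx).1.trans hw, (hs x hx).2⟩⟩

lemma HasCerts.weaken {f : (ι → Bool) → Bool} {b : Bool} {w : ℕ} (u : Prop)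
    (h : HasCerts True f b w) : HasCerts u f b w := by
  obtain ⟨s, hs⟩ := h
  exact ⟨s, fun x hx => ⟨(hs x hx).1, fun y hy =>
    ⟨((hs x hx).2 y hy).1, fun _ => ((hs x hx).2 y hy).2 trivial⟩⟩⟩

open Classical in
/-- Certificates survive an identification or renaming of the input coordinates. -/
lemma HasCerts.comap {u : Prop} {f : (ι → Bool) → Bool} {b : Bool} {w : ℕ}
    (h : HasCerts u f b w) (e : ι → κ) :
    HasCerts u (fun x : κ → Bool => f (fun i => x (e i))) b w := by
  obtain ⟨s, hs⟩ := h
  refine ⟨fun x => (s (fun i => x (e i))).image e, fun x hx => ?_⟩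
  obtain ⟨hcard, hcert⟩ := hs _ hx
  refine ⟨Finset.card_image_le.trans hcard, fun y hy => ?_⟩
  obtain ⟨h1, h2⟩ := hcert (fun i => y (e i))
    fun i hi => hy (e i) (Finset.mem_image_of_mem e hi)
  exact ⟨h1, fun hu => congrArg (Finset.image e) (h2 hu)⟩

/-- A choice of certificates for both values at once. -/
lemma HasCerts.both {u : Prop} {f : (ι → Bool) → Bool} {w : Bool → ℕ}
    (h : ∀ b, HasCerts u f b (w b)) :
    ∃ s : (ι → Bool) → Finset ι, ∀ x, (s x).card ≤ w (f x) ∧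
      ∀ y, (∀ i ∈ s x, y i = x i) → f y = f x ∧ (u → s y = s x) := by
  choose s hs using h
  refine ⟨fun x => s (f x) x, fun x => ⟨(hs _ x rfl).1, fun y hy => ?_⟩⟩
  obtain ⟨h1, h2⟩ := (hs _ x rfl).2 y hy
  exact ⟨h1, fun hu => by simpa only [h1] using h2 hu⟩

end General

/-! ### Composition with AND and OR -/

section Gate

variable {ι : Type*} {n : ℕ}

open Classical in
/-- The gate on `n` blocks which outputs `v` as soon as some block evaluates to `v`: it is
the composition of `f` with OR for `v = true` and with AND for `v = false`. -/
noncomputable def gate (n : ℕ) (v : Bool) (f : (ι → Bool) → Bool) (y : Fin n × ι → Bool) : Bool :=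
  if ∃ i, f (fun j => y (i, j)) = v then v else !v

lemma gate_eq_iff {v : Bool} {f : (ι → Bool) → Bool} {y : Fin n × ι → Bool} :
    gate n v f y = v ↔ ∃ i, f (fun j => y (i, j)) = v := by
  unfold gate
  split_ifs with h <;> simp [h]

lemma gate_eq_not_iff {v : Bool} {f : (ι → Bool) → Bool} {y : Fin n × ι → Bool} :
    gate n v f y = !v ↔ ∀ i, f (fun j => y (i, j)) = !v := by
  unfold gate
  split_ifs with h
  · obtain ⟨i, hi⟩ := h
    simp only [Bool.eq_not_self, false_iff, not_forall]
    exact ⟨i, by simp [hi]⟩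
  · push Not at h
    simpa using fun i => Bool.eq_not.2 (h i)

/-- The set of coordinates `(i, j)` such that `j` belongs to the set `s i`. -/
def blockUnion {m : ℕ} (s : Fin m → Finset ι) : Finset (Fin m × ι) :=
  (Finset.univ.sigma s).map (Equiv.sigmaEquivProd _ _).toEmbedding

lemma mem_blockUnion {s : Fin n → Finset ι} {i : Fin n} {j : ι} :
    (i, j) ∈ blockUnion s ↔ j ∈ s i := by
  simp [blockUnion, Equiv.sigmaEquivProd]

lemma card_blockUnion (s : Fin n → Finset ι) :
    (blockUnion s).card = ∑ i, (s i).card := by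
  simp [blockUnion]

lemma card_blockUnion_le {s : Fin n → Finset ι} {w : ℕ} (h : ∀ i, (s i).card ≤ w) :
    (blockUnion s).card ≤ n * w := by
  rw [card_blockUnion]
  simpa using Finset.sum_le_card_nsmul Finset.univ _ w fun i _ => h i

lemma HasCerts.gate_of_exists {f : (ι → Bool) → Bool} {v : Bool} {w : ℕ}
    (h : HasCerts False f v w) : HasCerts False (gate n v f) v w := by
  obtain ⟨s, hs⟩ := h
  have hex : ∀ x : Fin n × ι → Bool, gate n v f x = v → ∃ i, f (fun j => x (i, j)) = v :=
    fun x hx => gate_eq_iff.1 hx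
  by_cases hne : ∃ x : Fin n × ι → Bool, gate n v f x = v
  · obtain ⟨x₀, hx₀⟩ := hne
    have : Nonempty (Fin n) := ⟨(hex x₀ hx₀).choose⟩
    choose! i hi using hex
    refine ⟨fun x => (s (fun j => x (i x, j))).map
      ⟨fun j => (i x, j), fun a b h => by simpa using h⟩, fun x hx => ⟨?_, fun y hy => ⟨?_, False.elim⟩⟩⟩
    · rw [Finset.card_map]
      exact (hs _ (hi x hx)).1
    · refine gate_eq_iff.2 ⟨i x, ((hs _ (hi x hx)).2 _ fun j hj => hy _ ?_).1⟩
      exact Finset.mem_map_of_mem _ hj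
  · exact ⟨fun _ => ∅, fun x hx => (hne ⟨x, hx⟩).elim⟩

lemma HasCerts.gate_of_forall {u : Prop} {f : (ι → Bool) → Bool} {v : Bool} {w : ℕ}
    (h : HasCerts u f (!v) w) : HasCerts u (gate n v f) (!v) (n * w) := by
  obtain ⟨s, hs⟩ := h
  refine ⟨fun x => blockUnion fun i => s fun j => x (i, j), fun x hx => ?_⟩
  rw [gate_eq_not_iff] at hx
  refine ⟨card_blockUnion_le fun i => (hs _ (hx i)).1, fun y hy => ?_⟩
  have hy' := fun i => (hs _ (hx i)).2 (fun j => y (i, j))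
    fun j hj => hy (i, j) (mem_blockUnion.2 hj)
  refine ⟨gate_eq_not_iff.2 fun i => (hy' i).1, fun hu => ?_⟩
  exact congrArg blockUnion (funext fun i => (hy' i).2 hu)

open Classical in
lemma HasCerts.gate_of_first {f : (ι → Bool) → Bool} {v : Bool} {w w' : ℕ}
    (h : HasCerts True f v w) (h' : HasCerts True f (!v) w') :
    HasCerts True (gate n v f) v (n * w' + w) := by
  obtain ⟨s, hs⟩ := HasCerts.both (u := True) (f := f) (w := fun b => if b = v then w else w') (by
    intro b
    by_cases hb : b = v
    · simpa [hb] using h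
    · simpa [hb, Bool.eq_not.2 hb] using h')
  refine ⟨fun x => blockUnion fun i =>
    if ∀ i' < i, f (fun j => x (i', j)) = !v then s fun j => x (i, j) else ∅, fun x hx => ?_⟩
  obtain ⟨i₀, hi₀, hmin⟩ := WellFounded.has_min (wellFounded_lt (α := Fin n))
    {i | f (fun j => x (i, j)) = v} (gate_eq_iff.1 hx)
  have hi₀ : f (fun j => x (i₀, j)) = v := hi₀
  have hlt : ∀ i < i₀, f (fun j => x (i, j)) = !v :=
    fun i hi => Bool.eq_not.2 fun hc => hmin i hc hi
  constructor
  · rw [card_blockUnion]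
    calc _ ≤ ∑ i : Fin n, (w' + if i = i₀ then w else 0) := Finset.sum_le_sum fun i _ => by
          split_ifs with h1 h2 h2
          · have := (hs fun j => x (i, j)).1
            rw [h2, if_pos hi₀] at this
            rw [h2]
            omega
          · have hne : f (fun j => x (i, j)) ≠ v := by
              rcases lt_trichotomy i i₀ with h3 | h3 | h3
              · simp [hlt i h3]
              · exact (h2 h3).elim
              · have := h1 i₀ h3
                simp [hi₀] at this
            have := (hs fun j => x (i, j)).1
            rw [if_neg hne] at this
            omega
          · simp
          · simp
      _ = n * w' + w := by simp [Finset.sum_add_distrib]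
  · intro y hy
    have hy' : ∀ i ≤ i₀, f (fun j => y (i, j)) = f (fun j => x (i, j)) ∧
        (True → s (fun j => y (i, j)) = s (fun j => x (i, j))) := by
      intro i hi
      refine (hs _).2 _ fun j hj => hy (i, j) (mem_blockUnion.2 ?_)
      rw [if_pos fun i' hi' => hlt i' (hi'.trans_le hi)]
      exact hj
    refine ⟨gate_eq_iff.2 ⟨i₀, (hy' i₀ le_rfl).1.trans hi₀⟩, fun _ => ?_⟩
    refine congrArg blockUnion (funext fun i => ?_)
    rcases le_or_gt i i₀ with hi | hi
    · rw [if_pos fun i' hi' => hlt i' (hi'.trans_le hi), if_pos fun i' hi' => ?_,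
        (hy' i hi).2 trivial]
      rw [(hy' i' (hi'.le.trans hi)).1, hlt i' (hi'.trans_le hi)]
    · rw [if_neg fun hc => ?_, if_neg fun hc => ?_]
      · have := hc i₀ hi
        simp [hi₀] at this
      · have := hc i₀ hi
        simp [(hy' i₀ le_rfl).1, hi₀] at this

lemma composeFn_ANDn {m : ℕ} (f : (Fin m → Bool) → Bool) :
    composeFn (ANDn n) f = fun y => gate n false f (fun a => y (finProdFinEquiv a)) := by
  funext y
  by_cases h : ∀ i, f (fun j => y (finProdFinEquiv (i, j))) = true
  · simp [composeFn, ANDn, gate, h]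
  · have h' : ∃ i, f (fun j => y (finProdFinEquiv (i, j))) = false := by simpa using h
    simp [composeFn, ANDn, gate, h']

lemma composeFn_ORn {m : ℕ} (f : (Fin m → Bool) → Bool) :
    composeFn (ORn n) f = fun y => gate n true f (fun a => y (finProdFinEquiv a)) := by
  funext y
  by_cases h : ∃ i, f (fun j => y (finProdFinEquiv (i, j))) = true <;>
    simp [composeFn, ORn, gate, h]

lemma ANDn_eq_gate : ANDn n = fun y => gate n false (fun z : Unit → Bool => z ())
    (fun a => y a.1) := by
  funext y
  by_cases h : ∀ i, y i = true
  · simp [ANDn, gate, h]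
  · have h' : ∃ i, y i = false := by simpa using h
    simp [ANDn, gate, h']

lemma hasCerts_unit (u : Prop) (b : Bool) :
    HasCerts u (fun z : Unit → Bool => z ()) b 1 :=
  ⟨fun _ => Finset.univ, fun x hx => ⟨by simp, fun y hy =>
    ⟨(hy () (Finset.mem_univ _)).trans hx, fun _ => rfl⟩⟩⟩

end Gate

/-! ### Certificates of cheat sheet functions -/

lemma card_paDom_decodePA_le (N L Cf : ℕ) {m : ℕ} (Y : Fin m → Bool) (i : ℕ) :
    (paDom (decodePA N L Cf Y i)).card ≤ Cf := by
  rw [← Finset.card_range Cf]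
  refine (Finset.card_le_card (t := (Finset.range Cf).biUnion fun t => Finset.univ.filter
    fun j : Fin N => bitsToNat L (fun s => cellBit Y ((i * Cf + t) * (L + 1) + s)) = j)
    fun j hj => ?_).trans ?_
  · simp only [paDom, decodePA, Finset.mem_filter, Finset.mem_univ, true_and,
      Option.isSome_map, List.find?_isSome, List.mem_range, beq_iff_eq] at hj
    simpa using hj
  · refine (Finset.card_biUnion_le_card_mul _ _ 1 fun t _ => ?_).trans (by simp)
    rw [Finset.card_le_one]
    intro a ha b hb
    simp only [Finset.mem_filter, Finset.mem_univ, true_and] at ha hb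
    exact Fin.ext (ha.symm.trans hb)

section CheatSheet

variable {c N K m : ℕ}

/-- The cheat sheet function with an arbitrary addressing and decoding scheme. -/
def absCheatSheet (f : (Fin N → Bool) → Bool) (loc : (Fin c → Bool) → Fin K)
    (dec : (Fin m → Bool) → Fin c → Fin N → Option Bool)
    (z : (Fin c × Fin N) ⊕ (Fin K × Fin m) → Bool) : Bool :=
  decide (∀ i : Fin c,
    Consistent (fun j => z (Sum.inl (i, j)))
      (dec (fun j => z (Sum.inr (loc fun i => f fun j => z (Sum.inl (i, j)), j))) i) ∧
    IsCert f (f fun j => z (Sum.inl (i, j)))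
      (dec (fun j => z (Sum.inr (loc fun i => f fun j => z (Sum.inl (i, j)), j))) i))

variable {f : (Fin N → Bool) → Bool} {loc : (Fin c → Bool) → Fin K}
  {dec : (Fin m → Bool) → Fin c → Fin N → Option Bool}

/-- The content of the addressed cell. -/
def activeCell (f : (Fin N → Bool) → Bool) (loc : (Fin c → Bool) → Fin K)
    (z : (Fin c × Fin N) ⊕ (Fin K × Fin m) → Bool) : Fin m → Bool :=
  fun j => z (Sum.inr (loc fun i => f fun j => z (Sum.inl (i, j)), j))

/-- The addressed cell, the coordinates that its partial assignments mention, and further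
coordinates `s i` of the `i`-th block. -/
def cellQueries (f : (Fin N → Bool) → Bool) (loc : (Fin c → Bool) → Fin K)
    (dec : (Fin m → Bool) → Fin c → Fin N → Option Bool) (s : (Fin N → Bool) → Finset (Fin N))
    (z : (Fin c × Fin N) ⊕ (Fin K × Fin m) → Bool) :
    Finset ((Fin c × Fin N) ⊕ (Fin K × Fin m)) :=
  (blockUnion fun i => paDom (dec (activeCell f loc z) i) ∪ s fun j => z (Sum.inl (i, j))).disjSum
    ({loc fun i => f fun j => z (Sum.inl (i, j))} ×ˢ Finset.univ)

lemma card_cellQueries_le {C w : ℕ} {s : (Fin N → Bool) → Finset (Fin N)}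
    (hdec : ∀ Y i, (paDom (dec Y i)).card ≤ C) (hs : ∀ x, (s x).card ≤ w)
    (z : (Fin c × Fin N) ⊕ (Fin K × Fin m) → Bool) :
    (cellQueries f loc dec s z).card ≤ c * (C + w) + m := by
  unfold cellQueries
  rw [Finset.card_disjSum]
  refine Nat.add_le_add (card_blockUnion_le fun i => ?_) (by simp)
  exact (Finset.card_union_le _ _).trans (Nat.add_le_add (hdec _ _) (hs _))

lemma absCheatSheet_congr {s : (Fin N → Bool) → Finset (Fin N)}
    {y z : (Fin c × Fin N) ⊕ (Fin K × Fin m) → Bool}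
    (hy : ∀ a ∈ cellQueries f loc dec s z, y a = z a)
    (hf : ∀ i, f (fun j => y (Sum.inl (i, j))) = f (fun j => z (Sum.inl (i, j)))) :
    absCheatSheet f loc dec y = absCheatSheet f loc dec z ∧
      activeCell f loc y = activeCell f loc z := by
  have hf' : (fun i => f (fun j => y (Sum.inl (i, j)))) =
    fun i => f (fun j => z (Sum.inl (i, j))) := funext hf
  have hcell : activeCell f loc y = activeCell f loc z := by
    funext j
    unfold activeCell
    rw [hf']
    exact hy _ (by simp [cellQueries])
  refine ⟨?_, hcell⟩
  change decide (∀ i, Consistent (fun j => y (Sum.inl (i, j))) (dec (activeCell f loc y) i) ∧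
    IsCert f (f fun j => y (Sum.inl (i, j))) (dec (activeCell f loc y) i)) =
    decide (∀ i, Consistent (fun j => z (Sum.inl (i, j))) (dec (activeCell f loc z) i) ∧
    IsCert f (f fun j => z (Sum.inl (i, j))) (dec (activeCell f loc z) i))
  rw [hcell]
  refine decide_eq_decide.2 (forall_congr' fun i => ?_)
  rw [hf i, consistent_congr fun j hj => hy (Sum.inl (i, j)) ?_]
  simp [cellQueries, mem_blockUnion, hj]

lemma cellQueries_congr {s : (Fin N → Bool) → Finset (Fin N)}
    {y z : (Fin c × Fin N) ⊕ (Fin K × Fin m) → Bool}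
    (hf : ∀ i, f (fun j => y (Sum.inl (i, j))) = f (fun j => z (Sum.inl (i, j))))
    (hcell : activeCell f loc y = activeCell f loc z)
    (hs : ∀ i, s (fun j => y (Sum.inl (i, j))) = s (fun j => z (Sum.inl (i, j)))) :
    cellQueries f loc dec s y = cellQueries f loc dec s z := by
  unfold cellQueries
  simp only [hf, hcell, hs]

lemma hasCerts_absCheatSheet {u : Prop} {C w : ℕ}
    (hdec : ∀ Y i, (paDom (dec Y i)).card ≤ C) (h : ∀ b, HasCerts u f b w) (b : Bool) :
    HasCerts u (absCheatSheet f loc dec) b (c * (C + w) + m) := by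
  obtain ⟨s, hs⟩ := HasCerts.both h
  refine ⟨cellQueries f loc dec s, fun z hz => ⟨card_cellQueries_le hdec (fun x => (hs x).1) z,
    fun y hy => ?_⟩⟩
  have hblock := fun i => (hs _).2 (fun j => y (Sum.inl (i, j)))
    fun j hj => hy (Sum.inl (i, j)) (by simp [cellQueries, mem_blockUnion, hj])
  obtain ⟨h1, h2⟩ := absCheatSheet_congr hy fun i => (hblock i).1
  exact ⟨h1.trans hz, fun hu => cellQueries_congr (fun i => (hblock i).1) h2
    fun i => (hblock i).2 hu⟩

lemma hasCerts_absCheatSheet_true {C : ℕ}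
    (hdec : ∀ Y i, (paDom (dec Y i)).card ≤ C) :
    HasCerts True (absCheatSheet f loc dec) true (c * C + m) := by
  refine ⟨cellQueries f loc dec fun _ => ∅, fun z hz => ⟨?_, fun y hy => ?_⟩⟩
  · simpa using card_cellQueries_le (w := 0) hdec (by simp) z
  · have hz' := of_decide_eq_true hz
    have hf : ∀ i, f (fun j => y (Sum.inl (i, j))) = f (fun j => z (Sum.inl (i, j))) := by
      intro i
      refine (hz' i).2 _ ((consistent_congr fun j hj => ?_).2 (hz' i).1)
      refine hy (Sum.inl (i, j)) ?_
      simp only [cellQueries, Finset.inl_mem_disjSum, mem_blockUnion, Finset.mem_union]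
      exact Or.inl hj
    obtain ⟨h1, h2⟩ := absCheatSheet_congr hy hf
    exact ⟨h1.trans hz, fun _ => cellQueries_congr hf h2 fun _ => rfl⟩

end CheatSheet

lemma exists_absCheatSheet_eq {N : ℕ} (f : (Fin N → Bool) → Bool) :
    ∃ (loc : (Fin (10 * Nat.clog 2 N) → Bool) → Fin (2 ^ (10 * Nat.clog 2 N)))
      (dec : (Fin (10 * certCC f * (Nat.clog 2 N) ^ 2) → Bool) →
        Fin (10 * Nat.clog 2 N) → Fin N → Option Bool),
      (∀ Y i, (paDom (dec Y i)).card ≤ certCC f) ∧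
      cheatSheet f = fun z => absCheatSheet f loc dec fun a => z (csIndex N (certCC f) a) :=
  ⟨fun b => ⟨(∑ i, if b i then 2 ^ (10 * Nat.clog 2 N - 1 - (i : ℕ)) else 0) %
      2 ^ (10 * Nat.clog 2 N), Nat.mod_lt _ (by positivity)⟩,
    fun Y i => decodePA N (Nat.clog 2 N) (certCC f) Y i,
    fun _ _ => card_paDom_decodePA_le _ _ _ _ _, rfl⟩

lemma hasCerts_cheatSheet {N : ℕ} {f : (Fin N → Bool) → Bool} {u : Prop} {w : ℕ}
    (h : ∀ b, HasCerts u f b w) (b : Bool) :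
    HasCerts u (cheatSheet f) b (10 * Nat.clog 2 N * (certCC f + w) +
      10 * certCC f * (Nat.clog 2 N) ^ 2) := by
  obtain ⟨loc, dec, hdec, heq⟩ := exists_absCheatSheet_eq f
  rw [heq]
  exact (hasCerts_absCheatSheet hdec h b).comap _

lemma hasCerts_cheatSheet_true {N : ℕ} (f : (Fin N → Bool) → Bool) :
    HasCerts True (cheatSheet f) true (10 * Nat.clog 2 N * certCC f +
      10 * certCC f * (Nat.clog 2 N) ^ 2) := by
  obtain ⟨loc, dec, hdec, heq⟩ := exists_absCheatSheet_eq f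
  rw [heq]
  exact (hasCerts_absCheatSheet_true hdec).comap _

/-! ### Growth of the family -/

lemma csCard_le {M C : ℕ} (hC : C ≤ M) : csCard M C ≤ 41000 * M ^ 12 := by
  unfold csCard
  rcases Nat.lt_or_ge 1 M with hM | hM
  · set L := Nat.clog 2 M with hL
    have hpow : 2 ^ L ≤ 2 * M := by
      have h1 := Nat.pow_pred_clog_lt_self (b := 2) (by norm_num) hM
      have h2 : 0 < L := Nat.clog_pos (by norm_num) hM
      rw [← hL] at h1
      obtain ⟨l, hl⟩ := Nat.exists_eq_succ_of_ne_zero h2.ne'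
      rw [hl] at h1 ⊢
      rw [pow_succ]
      simp only [Nat.pred_succ] at h1
      omega
    have hsq : L ^ 2 ≤ 4 * M := by
      have key : ∀ l : ℕ, l ^ 2 ≤ 2 * 2 ^ l := by
        intro l
        induction l with
        | zero => norm_num
        | succ k ih =>
          rcases Nat.lt_or_ge k 3 with hk | hk
          · interval_cases k <;> norm_num
          · rw [pow_succ 2 k]
            nlinarith
      have := key L
      omega
    have hL2 : L ≤ 2 * M := (Nat.lt_two_pow_self).le.trans hpow
    have h10 : 2 ^ (10 * L) ≤ (2 * M) ^ 10 := by
      rw [mul_comm, pow_mul]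
      exact Nat.pow_le_pow_left hpow 10
    calc 10 * L * M + 2 ^ (10 * L) * (10 * C * L ^ 2)
        ≤ 10 * (2 * M) * M + (2 * M) ^ 10 * (10 * M * (4 * M)) := by gcongr
      _ = 20 * M ^ 2 + 40960 * M ^ 12 := by ring
      _ ≤ 20 * M ^ 12 + 40960 * M ^ 12 := by
          have : M ^ 2 ≤ M ^ 12 := Nat.pow_le_pow_right (by omega) (by norm_num)
          omega
      _ ≤ 41000 * M ^ 12 := by omega
  · simp [Nat.clog_of_right_le_one hM]

lemma hasCerts_ANDn_comp_cheatSheet {n M D T : ℕ} (hn : 1 ≤ n) {f : (Fin M → Bool) → Bool} {c : ℕ}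
    (h0 : HasCerts False f false c) (hc : n * c ≤ D) (hu : ∀ b, HasCerts True f b D)
    (hT : Nat.clog 2 (n * M) ≤ T) :
    HasCerts False (composeFn (ANDn n) (cheatSheet (composeFn (ORn n) f))) false
      (30 * D * T ^ 2) ∧
    ∀ b, HasCerts True (composeFn (ANDn n) (cheatSheet (composeFn (ORn n) f))) b
      (60 * n * D * T ^ 2) := by
  have hTT : T ≤ T ^ 2 := Nat.le_self_pow (by norm_num) T
  have hOR : ∀ b, HasCerts False (composeFn (ORn n) f) b D := by
    rw [composeFn_ORn]
    rintro (_ | _)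
    · exact ((HasCerts.gate_of_forall (v := true) h0).mono hc).comap _
    · exact (HasCerts.gate_of_exists ((hu true).weaken False)).comap _
  have hORu : ∀ b, HasCerts True (composeFn (ORn n) f) b (n * D + D) := by
    rw [composeFn_ORn]
    rintro (_ | _)
    · exact ((HasCerts.gate_of_forall (v := true) (hu false)).mono (by omega)).comap _
    · exact (HasCerts.gate_of_first (hu true) (hu false)).comap _
  have hCC : certCC (composeFn (ORn n) f) ≤ D :=
    max_le (hOR false).certC_le (hOR true).certC_le
  have hCS1 := (hasCerts_cheatSheet_true (composeFn (ORn n) f)).mono (w' := 20 * D * T ^ 2) (by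
    calc _ ≤ 10 * T * D + 10 * D * T ^ 2 := by gcongr
      _ ≤ 10 * T ^ 2 * D + 10 * D * T ^ 2 := by gcongr
      _ = 20 * D * T ^ 2 := by ring)
  have hCS0 := (hasCerts_cheatSheet hOR false).mono (w' := 30 * D * T ^ 2) (by
    calc _ ≤ 10 * T * (D + D) + 10 * D * T ^ 2 := by gcongr
      _ ≤ 10 * T ^ 2 * (D + D) + 10 * D * T ^ 2 := by gcongr
      _ = 30 * D * T ^ 2 := by ring)
  have hCSu := (hasCerts_cheatSheet hORu false).mono (w' := 40 * n * D * T ^ 2) (by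
    calc _ ≤ 10 * T * (D + (n * D + D)) + 10 * D * T ^ 2 := by gcongr
      _ ≤ 10 * T ^ 2 * (n * D + (n * D + n * D)) + 10 * (n * D) * T ^ 2 := by
          gcongr <;> exact Nat.le_mul_of_pos_left D hn
      _ = 40 * n * D * T ^ 2 := by ring)
  rw [composeFn_ANDn]
  refine ⟨(HasCerts.gate_of_exists hCS0).comap _, ?_⟩
  rintro (_ | _)
  · refine ((HasCerts.gate_of_first hCSu hCS1).mono (le_of_eq ?_)).comap _
    ring
  · refine ((HasCerts.gate_of_forall (v := false) hCS1).mono ?_).comap _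
    calc n * (20 * D * T ^ 2) = 20 * (n * D * T ^ 2) := by ring
      _ ≤ 60 * (n * D * T ^ 2) := by gcongr; norm_num
      _ = 60 * n * D * T ^ 2 := by ring

lemma clog_mul_le {n N a e : ℕ} (hn : 2 ≤ n) (hN : N ≤ a * n ^ e) :
    Nat.clog 2 (n * N) ≤ (Nat.clog 2 a + (e + 1)) * Nat.clog 2 n := by
  have hl : 1 ≤ Nat.clog 2 n := Nat.clog_pos (by norm_num) hn
  refine (Nat.clog_le_of_le_pow (y := Nat.clog 2 a + (e + 1) * Nat.clog 2 n) ?_).trans ?_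
  · calc n * N ≤ n * (a * n ^ e) := by gcongr
      _ = a * n ^ (e + 1) := by ring
      _ ≤ 2 ^ Nat.clog 2 a * (2 ^ Nat.clog 2 n) ^ (e + 1) := by
          gcongr <;> exact Nat.le_pow_clog (by norm_num) _
      _ = 2 ^ (Nat.clog 2 a + (e + 1) * Nat.clog 2 n) := by
          rw [pow_add 2, ← pow_mul, mul_comm (Nat.clog 2 n)]
  · nlinarith [Nat.zero_le (Nat.clog 2 a)]

lemma family_bounds (k : ℕ) :
    ∃ a d : ℕ, 0 < a ∧ ∀ n : ℕ, 2 ≤ n →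
      (family n k).1 ≤ a * n ^ 25 ^ k ∧
      HasCerts False (family n k).2 false (a * n ^ k * Nat.clog 2 n ^ d) ∧
      ∀ b, HasCerts True (family n k).2 b (a * n ^ (k + 1) * Nat.clog 2 n ^ d) := by
  induction k with
  | zero =>
    refine ⟨2, 0, by norm_num, fun n hn => ⟨?_, ?_, ?_⟩⟩
    · change n ≤ 2 * n ^ 25 ^ 0
      rw [pow_zero, pow_one]
      omega
    · change HasCerts False (ANDn n) _ _
      rw [ANDn_eq_gate]
      exact ((HasCerts.gate_of_exists (hasCerts_unit _ _)).mono (by simp)).comap _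
    · intro b
      exact (hasCerts_full True (ANDn n) b).mono (by simp; omega)
  | succ k ih =>
    obtain ⟨a, d, ha, h⟩ := ih
    refine ⟨60 * a * (Nat.clog 2 a + (25 ^ k + 1)) ^ 2 + 41000 * a ^ 12, d + 2, by positivity,
      fun n hn => ?_⟩
    obtain ⟨hN, h0, hu⟩ := h n hn
    have hT := clog_mul_le hn hN
    set K := Nat.clog 2 a + (25 ^ k + 1)
    obtain ⟨hF0, hFu⟩ := hasCerts_ANDn_comp_cheatSheet (by omega) h0
      (D := a * n ^ (k + 1) * Nat.clog 2 n ^ d) (le_of_eq (by ring)) hu hT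
    refine ⟨?_, hF0.mono ?_, fun b => (hFu b).mono ?_⟩
    · calc n * csCard (n * (family n k).1) (certCC (composeFn (ORn n) (family n k).2))
          ≤ n * (41000 * (n * (family n k).1) ^ 12) := by
            gcongr
            exact csCard_le (certCC_le_size _)
        _ ≤ n * (41000 * (n * (a * n ^ 25 ^ k)) ^ 12) := by gcongr
        _ = 41000 * a ^ 12 * n ^ (12 * 25 ^ k + 13) := by ring
        _ ≤ (60 * a * K ^ 2 + 41000 * a ^ 12) * n ^ 25 ^ (k + 1) := by
            have h25 : 1 ≤ 25 ^ k := Nat.one_le_pow _ _ (by norm_num)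
            have he : 12 * 25 ^ k + 13 ≤ 25 ^ (k + 1) := by
              rw [pow_succ]
              omega
            gcongr
            · exact Nat.le_add_left _ _
            · omega
    · calc 30 * (a * n ^ (k + 1) * Nat.clog 2 n ^ d) * (K * Nat.clog 2 n) ^ 2
          = 30 * a * K ^ 2 * n ^ (k + 1) * Nat.clog 2 n ^ (d + 2) := by ring
        _ ≤ _ := by
            gcongr
            calc 30 * a * K ^ 2 ≤ 60 * a * K ^ 2 := by gcongr; norm_num
              _ ≤ _ := Nat.le_add_right _ _
    · calc 60 * n * (a * n ^ (k + 1) * Nat.clog 2 n ^ d) * (K * Nat.clog 2 n) ^ 2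
          = 60 * a * K ^ 2 * n ^ (k + 1 + 1) * Nat.clog 2 n ^ (d + 2) := by ring
        _ ≤ _ := by
            gcongr
            exact Nat.le_add_right _ _

lemma clog_le_two_mul_logb {n : ℕ} (hn : 2 ≤ n) : (Nat.clog 2 n : ℝ) ≤ 2 * Real.logb 2 n := by
  have h1 : (1 : ℝ) ≤ Real.logb 2 n := by
    rw [Real.le_logb_iff_rpow_le (by norm_num) (by positivity), Real.rpow_one]
    exact_mod_cast hn
  have h2 := Real.natCeil_logb_natCast 2 n
  rw [← h2]
  have := Nat.ceil_lt_add_one (a := Real.logb 2 n) (by linarith)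
  push_cast
  linarith

theorem stmt17 (k : ℕ) :
    ∃ (a : ℝ) (d : ℕ), 0 < a ∧ 0 < d ∧ ∀ n : ℕ, 2 ≤ n →
      ((family n k).1 : ℝ) ≤ a * (n : ℝ) ^ (25 ^ k) ∧
      (certC (family n k).2 false : ℝ) ≤ a * (n : ℝ) ^ k * Real.logb 2 n ^ d ∧
      (certC (family n k).2 true : ℝ) ≤ a * (n : ℝ) ^ (k + 1) * Real.logb 2 n ^ d ∧
      (UCb (family n k).2 false : ℝ) ≤ a * (n : ℝ) ^ (k + 1) * Real.logb 2 n ^ d ∧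
      (UCb (family n k).2 true : ℝ) ≤ a * (n : ℝ) ^ (k + 1) * Real.logb 2 n ^ d := by
  obtain ⟨a, d, ha, h⟩ := family_bounds k
  refine ⟨a * 2 ^ (d + 1), d + 1, by positivity, by omega, fun n hn => ?_⟩
  obtain ⟨hN, h0, hu⟩ := h n hn
  have hl : 1 ≤ Nat.clog 2 n := Nat.clog_pos (by norm_num) hn
  have key : ∀ w e : ℕ, w ≤ a * n ^ e * Nat.clog 2 n ^ d →
      (w : ℝ) ≤ a * 2 ^ (d + 1) * (n : ℝ) ^ e * Real.logb 2 n ^ (d + 1) := by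
    intro w e hw
    have hw' : w ≤ a * n ^ e * Nat.clog 2 n ^ (d + 1) :=
      hw.trans (Nat.mul_le_mul_left _ (Nat.pow_le_pow_right hl (by omega)))
    calc (w : ℝ) ≤ a * n ^ e * (Nat.clog 2 n : ℝ) ^ (d + 1) := by exact_mod_cast hw'
      _ ≤ a * n ^ e * (2 * Real.logb 2 n) ^ (d + 1) := by
          gcongr
          exact clog_le_two_mul_logb hn
      _ = _ := by ring
  have htrue : certC (family n k).2 true ≤ a * n ^ (k + 1) * Nat.clog 2 n ^ d :=
    ((hu true).weaken False).certC_le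
  refine ⟨?_, key _ _ h0.certC_le, key _ _ htrue, key _ _ (hu false).UCb_le,
    key _ _ (hu true).UCb_le⟩
  calc ((family n k).1 : ℝ) ≤ a * (n : ℝ) ^ 25 ^ k := by exact_mod_cast hN
    _ ≤ a * 2 ^ (d + 1) * (n : ℝ) ^ 25 ^ k := by
        gcongr
        exact le_mul_of_one_le_right (by positivity) (one_le_pow₀ (by norm_num))
end

section
/- For every total Boolean function h : {0,1}^n → {0,1} and every total Boolean function f : {0,1}^m → {0,1}, the subcube partition complexity of the composition satisfies UC(h ∘ f) ≤ n · UC(f), i.e., both UC_0(h ∘ f) ≤ n · UC(f) and UC_1(h ∘ f) ≤ n · UC(f). -/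
/-- The partial assignment on `n * m` bits whose `i`-th block is `p i`. -/
def concatPA {n m : ℕ} (p : Fin n → Fin m → Option Bool) : Fin (n * m) → Option Bool :=
  fun k => p (finProdFinEquiv.symm k).1 (finProdFinEquiv.symm k).2

theorem consistent_concatPA {n m : ℕ} (p : Fin n → Fin m → Option Bool)
    (y : Fin (n * m) → Bool) :
    Consistent y (concatPA p) ↔
      ∀ i, Consistent (fun j => y (finProdFinEquiv (i, j))) (p i) := by
  constructor
  · intro H i j c hc
    exact H _ _ (by simpa only [concatPA, Equiv.symm_apply_apply] using hc)
  · intro H k c hc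
    simpa only [Prod.mk.eta, Equiv.apply_symm_apply] using H _ _ c hc

theorem paWidth_concatPA {n m : ℕ} (p : Fin n → Fin m → Option Bool) :
    paWidth (concatPA p) = ∑ i, paWidth (p i) := by
  simp only [paWidth, Finset.card_filter]
  rw [← finProdFinEquiv.sum_comp, Fintype.sum_prod_type]
  simp only [concatPA, Equiv.symm_apply_apply]

theorem UCb_le_UC {n : ℕ} (f : (Fin n → Bool) → Bool) (b : Bool) : UCb f b ≤ UC f := by
  cases b
  · exact le_max_left _ _
  · exact le_max_right _ _

theorem UCb_composeFn_le {n m : ℕ} (h : (Fin n → Bool) → Bool) (f : (Fin m → Bool) → Bool)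
    (b : Bool) : UCb (composeFn h f) b ≤ n * UC f := by
  choose S hcert huniq using exists_unambiguous_certs f
  refine Nat.sInf_le ⟨{q | ∃ z : Fin n → Bool, h z = b ∧ ∃ p : Fin n → Fin m → Option Bool,
    (∀ i, p i ∈ S (z i)) ∧ q = concatPA p}, ?_, ?_⟩
  · rintro _ ⟨z, hz, p, hp, rfl⟩
    refine ⟨fun y hy => ?_, ?_⟩
    · rw [consistent_concatPA] at hy
      rw [← hz]
      exact congrArg h (funext fun i => (hcert _ _ (hp i)).1 _ (hy i))
    · rw [paWidth_concatPA]
      calc ∑ i, paWidth (p i) ≤ ∑ _i : Fin n, UC f :=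
            Finset.sum_le_sum fun i _ => (hcert _ _ (hp i)).2.trans (UCb_le_UC f _)
        _ = n * UC f := by simp
  · intro y hy
    choose p hp hpu using fun i => huniq _ (fun j => y (finProdFinEquiv (i, j))) rfl
    refine ⟨concatPA p, ⟨⟨_, hy, p, fun i => (hp i).1, rfl⟩,
      (consistent_concatPA p y).2 fun i => (hp i).2⟩, ?_⟩
    rintro _ ⟨⟨z, -, q, hq, rfl⟩, hyq⟩
    rw [consistent_concatPA] at hyq
    refine congrArg concatPA (funext fun i => hpu i _ ⟨?_, hyq i⟩)
    rw [(hcert _ _ (hq i)).1 _ (hyq i)]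
    exact hq i

theorem stmt19 {n m : ℕ} (h : (Fin n → Bool) → Bool) (f : (Fin m → Bool) → Bool) :
    UCb (composeFn h f) false ≤ n * UC f ∧ UCb (composeFn h f) true ≤ n * UC f :=
  ⟨UCb_composeFn_le h f false, UCb_composeFn_le h f true⟩
end
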